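/- Let G be a finite connected undirected graph with at least 3 vertices and maximum degree at most d. Then the vertex set of G can be partitioned into sets V(T_1),…,V(T_p), where each T_i is a subtree of G with at least 2 edges and at most 2d+1 vertices. -/

import Mathlib

namespace TreeSize

variable {V : Type*}

/-- One step along an edge of `G` inside `S`. -/
def Stp (G : SimpleGraph V) (S : Finset V) (x y : V) : Prop := G.Adj x y ∧ x ∈ S ∧ y ∈ S

/-- Reachability inside `S`. -/
def Rch (G : SimpleGraph V) (S : Finset V) : V → V → Prop := Relation.ReflTransGen (Stp G S)

/-- Connectivity of `S`. -/
def Cn (G : SimpleGraph V) (S : Finset V) : Prop := ∀ a ∈ S, ∀ b ∈ S, Rch G S a b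

theorem Rch.symm {G : SimpleGraph V} {S : Finset V} {a b : V} (h : Rch G S a b) : Rch G S b a := by
  unfold Rch at *
  induction h with
  | refl => exact .refl
  | tail _ h ih => exact .head ⟨h.1.symm, h.2.2, h.2.1⟩ ih

theorem Rch.mono {G : SimpleGraph V} {S T : Finset V} (hST : S ⊆ T) {a b : V} (h : Rch G S a b) :
    Rch G T a b :=
  Relation.ReflTransGen.mono (r := Stp G S) (p := Stp G T)
    (fun _ _ h => ⟨h.1, hST h.2.1, hST h.2.2⟩) a b h

theorem Rch.trans {G : SimpleGraph V} {S : Finset V} {a b c : V} (h : Rch G S a b)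
    (h' : Rch G S b c) : Rch G S a c := Relation.ReflTransGen.trans h h'

theorem Rch.mem {G : SimpleGraph V} {S : Finset V} {a b : V} (h : Rch G S a b) (ha : a ∈ S) :
    b ∈ S := by
  unfold Rch at h
  induction h with
  | refl => exact ha
  | tail _ h ih => exact h.2.2

theorem Cn.of_star {G : SimpleGraph V} {S : Finset V} (v : V) (h : ∀ w ∈ S, Rch G S v w) :
    Cn G S := fun a ha b hb => (h a ha).symm.trans (h b hb)

theorem Cn.union [DecidableEq V] {G : SimpleGraph V} {S T : Finset V} (hS : Cn G S) (hT : Cn G T)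
    {s t : V} (hs : s ∈ S) (ht : t ∈ T) (h : G.Adj s t) : Cn G (S ∪ T) := by
  apply Cn.of_star s
  intro w hw
  rcases Finset.mem_union.1 hw with hw | hw
  · exact (hS s hs w hw).mono Finset.subset_union_left
  · refine Rch.trans (.single ⟨h, ?_, ?_⟩) ((hT t ht w hw).mono Finset.subset_union_right)
    · exact Finset.mem_union_left _ hs
    · exact Finset.mem_union_right _ ht

theorem Cn.induce {G : SimpleGraph V} {S : Finset V} (h : Cn G S) (hne : S.Nonempty) :
    (G.induce (S : Set V)).Connected := by
  obtain ⟨v, hv⟩ := hne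
  have key : ∀ w (hw : w ∈ S), Rch G S v w →
      (G.induce (S : Set V)).Reachable ⟨v, hv⟩ ⟨w, hw⟩ := by
    intro w hw hr
    unfold Rch at hr
    induction hr with
    | refl => exact .refl _
    | tail _ h ih =>
      refine (ih h.2.1).trans (SimpleGraph.Adj.reachable ?_)
      exact h.1
  have : Nonempty (S : Set V) := ⟨⟨v, hv⟩⟩
  refine ⟨fun a b => ?_⟩
  exact (key a.1 a.2 (h v hv a.1 a.2)).symm.trans (key b.1 b.2 (h v hv b.1 b.2))

theorem exists_branch [DecidableEq V] (G : SimpleGraph V) [DecidableRel G.Adj]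
    (A : Finset V) (hA : Cn G A) (v : V) (hv : v ∈ A) (k : ℕ)
    (hk : (A.filter (G.Adj v)).card ≤ k) (hcard : 2 * k + 1 < A.card) :
    ∃ C ⊆ A.erase v, 3 ≤ C.card ∧ Cn G C ∧ Cn G (A \ C) := by
  classical
  let B := A.erase v
  let C : V → Finset V := fun u => B.filter (fun w => Rch G B u w)
  have hcov : ∀ w, Rch G A v w → w = v ∨ ∃ u ∈ A.filter (G.Adj v), Rch G B u w := by
    intro w hw
    unfold Rch at hw
    induction hw with
    | refl => exact .inl rfl
    | @tail x y _ h ih =>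
      by_cases hy : y = v
      · exact .inl hy
      right
      rcases ih with rfl | ⟨u, hu, hr⟩
      · exact ⟨y, Finset.mem_filter.2 ⟨h.2.2, h.1⟩, .refl⟩
      · by_cases hx : x = v
        · subst hx
          exact ⟨y, Finset.mem_filter.2 ⟨h.2.2, h.1⟩, .refl⟩
        · exact ⟨u, hu, hr.tail ⟨h.1, Finset.mem_erase.2 ⟨hx, h.2.1⟩,
            Finset.mem_erase.2 ⟨hy, h.2.2⟩⟩⟩
  have hsub : B ⊆ (A.filter (G.Adj v)).biUnion C := by
    intro w hw
    have hw' := Finset.mem_erase.1 hw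
    rcases hcov w (hA v hv w hw'.2) with h | ⟨u, hu, hr⟩
    · exact absurd h hw'.1
    · exact Finset.mem_biUnion.2 ⟨u, hu, Finset.mem_filter.2 ⟨hw, hr⟩⟩
  have hex : ∃ u ∈ A.filter (G.Adj v), 3 ≤ (C u).card := by
    by_contra! hcon
    have h1 := Finset.card_le_card hsub
    have h2 := Finset.card_biUnion_le_card_mul (A.filter (G.Adj v)) C 2
      (fun u hu => by have := hcon u hu; omega)
    have h3 : B.card = A.card - 1 := Finset.card_erase_of_mem hv
    omega
  obtain ⟨u, hu, hc⟩ := hex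
  have hpath : ∀ x, x ∈ B → ∀ w, Rch G B x w → Rch G (C x) x w := by
    intro x hx w hw
    unfold Rch at hw
    induction hw with
    | refl => exact .refl
    | tail h1 h ih =>
      exact Relation.ReflTransGen.tail ih ⟨h.1, Finset.mem_filter.2 ⟨h.2.1, h1⟩,
        Finset.mem_filter.2 ⟨h.2.2, h1.tail h⟩⟩
  have hNB : ∀ x ∈ A.filter (G.Adj v), x ∈ B := fun x hx =>
    Finset.mem_erase.2 ⟨(Finset.mem_filter.1 hx).2.ne', (Finset.mem_filter.1 hx).1⟩
  have hvC : v ∈ A \ C u := Finset.mem_sdiff.2 ⟨hv, fun h => by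
    have := (Finset.mem_filter.1 h).1
    exact (Finset.mem_erase.1 this).1 rfl⟩
  refine ⟨C u, Finset.filter_subset _ _, hc, ?_, ?_⟩
  · exact Cn.of_star u fun w hw => hpath u (hNB u hu) w (Finset.mem_filter.1 hw).2
  · apply Cn.of_star v
    intro w hw
    have hw' := Finset.mem_sdiff.1 hw
    rcases hcov w (hA v hv w hw'.1) with rfl | ⟨x, hx, hr⟩
    · exact .refl
    have hxB := hNB x hx
    have hnot : ∀ y, Rch G B x y → y ∉ C u := by
      intro y hy hyC
      apply hw'.2
      exact Finset.mem_filter.2 ⟨hr.mem hxB, ((Finset.mem_filter.1 hyC).2.trans hy.symm).trans hr⟩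
    have hCs : C x ⊆ A \ C u := by
      intro y hy
      have := Finset.mem_filter.1 hy
      exact Finset.mem_sdiff.2 ⟨Finset.mem_of_mem_erase this.1, hnot y this.2⟩
    refine Rch.trans (.single ⟨(Finset.mem_filter.1 hx).2, hvC, ?_⟩) ((hpath x hxB w hr).mono hCs)
    exact hCs (Finset.mem_filter.2 ⟨hxB, .refl⟩)

theorem exists_cross {G : SimpleGraph V} {S C : Finset V} {a b : V} (h : Rch G S a b)
    (ha : a ∈ C) (hb : b ∉ C) : ∃ x ∈ C, ∃ y ∈ S, y ∉ C ∧ G.Adj x y := by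
  unfold Rch at h
  induction h with
  | refl => exact absurd ha hb
  | @tail x y _ h ih =>
    by_cases hx : x ∈ C
    · exact ⟨x, hx, y, h.2.2, hb, h.1⟩
    · exact ih hx

theorem exists_split [Fintype V] [DecidableEq V] (G : SimpleGraph V) [DecidableRel G.Adj]
    (d : ℕ) (hdeg : ∀ v, G.degree v ≤ d) (S : Finset V) (hS : Cn G S)
    (hcard : 2 * d + 1 < S.card) :
    ∃ C ⊆ S, 3 ≤ C.card ∧ 3 ≤ (S \ C).card ∧ Cn G C ∧ Cn G (S \ C) := by
  classical
  have hne : S.Nonempty := Finset.card_pos.1 (by omega)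
  obtain ⟨r, hr⟩ := hne
  have hdeg' : ∀ (A : Finset V) v, (A.filter (G.Adj v)).card ≤ d := by
    intro A v
    refine le_trans (Finset.card_le_card ?_) (hdeg v)
    intro x hx
    simpa using (Finset.mem_filter.1 hx).2
  have hex : ∃ n, ∃ C ⊆ S, C.card = n ∧ 3 ≤ C.card ∧ (S \ C).Nonempty ∧ Cn G C ∧ Cn G (S \ C) := by
    obtain ⟨C, hC, h3, h1, h2⟩ := exists_branch G S hS r hr d (hdeg' S r) hcard
    refine ⟨_, C, hC.trans (Finset.erase_subset _ _), rfl, h3, ⟨r, ?_⟩, h1, h2⟩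
    exact Finset.mem_sdiff.2 ⟨hr, fun h => (Finset.mem_erase.1 (hC h)).1 rfl⟩
  obtain ⟨C, hCS, hn, h3, ⟨b, hb⟩, h1, h2⟩ := Nat.find_spec hex
  by_cases hbig : 3 ≤ (S \ C).card
  · exact ⟨C, hCS, h3, hbig, h1, h2⟩
  exfalso
  have hb' := Finset.mem_sdiff.1 hb
  obtain ⟨a, ha⟩ : C.Nonempty := Finset.card_pos.1 (by omega)
  obtain ⟨v, hv, y, hyS, hyC, hvy⟩ := exists_cross (hS a (hCS ha) b hb'.1) ha hb'.2
  have hk : (C.filter (G.Adj v)).card + 1 ≤ d := by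
    have := hdeg' (insert y C) v
    rw [Finset.filter_insert, if_pos hvy, Finset.card_insert_of_notMem] at this
    · exact this
    · simp [hyC]
  have hsum := Finset.card_sdiff_add_card_eq_card hCS
  obtain ⟨C', hC', h3', h1', h2'⟩ := exists_branch G C h1 v hv (d - 1) (by omega) (by omega)
  have hvC' : v ∉ C' := fun h => (Finset.mem_erase.1 (hC' h)).1 rfl
  have hC'C : C' ⊆ C := hC'.trans (Finset.erase_subset _ _)
  have hlt : C'.card < C.card := Finset.card_lt_card ⟨hC'C, fun h => hvC' (h hv)⟩
  refine Nat.find_min hex (m := C'.card) (by omega)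
    ⟨C', hC'C.trans hCS, rfl, h3', ⟨v, Finset.mem_sdiff.2 ⟨hCS hv, hvC'⟩⟩, h1', ?_⟩
  have heq : S \ C' = (C \ C') ∪ (S \ C) := by
    ext x
    have := @hCS x
    have := @hC'C x
    simp only [Finset.mem_sdiff, Finset.mem_union]
    tauto
  rw [heq]
  exact h2'.union h2 (Finset.mem_sdiff.2 ⟨hv, hvC'⟩) (Finset.mem_sdiff.2 ⟨hyS, hyC⟩) hvy

theorem exists_partition [Fintype V] [DecidableEq V] (G : SimpleGraph V) [DecidableRel G.Adj]
    (d : ℕ) (hdeg : ∀ v, G.degree v ≤ d) (n : ℕ) : ∀ S : Finset V, S.card = n → 3 ≤ S.card →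
    Cn G S → ∃ P : Finset (Finset V), (∀ v ∈ S, ∃! T, T ∈ P ∧ v ∈ T) ∧
      ∀ T ∈ P, T ⊆ S ∧ 3 ≤ T.card ∧ T.card ≤ 2 * d + 1 ∧ Cn G T := by
  induction n using Nat.strong_induction_on with
  | _ n ih =>
  intro S hn h3 hS
  by_cases hle : S.card ≤ 2 * d + 1
  · refine ⟨{S}, fun v hv => ⟨S, by simp [hv], by simp⟩, ?_⟩
    intro T hT
    rw [Finset.mem_singleton] at hT
    subst hT
    exact ⟨subset_rfl, h3, hle, hS⟩
  obtain ⟨C, hCS, hc, hc', h1, h2⟩ := exists_split G d hdeg S hS (by omega)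
  have hsum := Finset.card_sdiff_add_card_eq_card hCS
  obtain ⟨P, hP, hP'⟩ := ih C.card (by omega) C rfl hc h1
  obtain ⟨Q, hQ, hQ'⟩ := ih (S \ C).card (by omega) (S \ C) rfl hc' h2
  refine ⟨P ∪ Q, ?_, ?_⟩
  · intro v hv
    by_cases hvC : v ∈ C
    · obtain ⟨T, hT, hu⟩ := hP v hvC
      refine ⟨T, ⟨Finset.mem_union_left _ hT.1, hT.2⟩, ?_⟩
      rintro T' ⟨hT', hvT'⟩
      rcases Finset.mem_union.1 hT' with h | h
      · exact hu T' ⟨h, hvT'⟩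
      · exact absurd hvC (Finset.mem_sdiff.1 ((hQ' T' h).1 hvT')).2
    · obtain ⟨T, hT, hu⟩ := hQ v (Finset.mem_sdiff.2 ⟨hv, hvC⟩)
      refine ⟨T, ⟨Finset.mem_union_right _ hT.1, hT.2⟩, ?_⟩
      rintro T' ⟨hT', hvT'⟩
      rcases Finset.mem_union.1 hT' with h | h
      · exact absurd ((hP' T' h).1 hvT') hvC
      · exact hu T' ⟨h, hvT'⟩
  · intro T hT
    rcases Finset.mem_union.1 hT with h | h
    · exact ⟨(hP' T h).1.trans hCS, (hP' T h).2⟩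
    · exact ⟨(hQ' T h).1.trans Finset.sdiff_subset, (hQ' T h).2⟩

end TreeSize

theorem stmt_5 {V : Type*} [Fintype V] [DecidableEq V]
    (G : SimpleGraph V) [DecidableRel G.Adj]
    (hconn : G.Connected) (h3 : 3 ≤ Fintype.card V)
    (d : ℕ) (hdeg : ∀ v, G.degree v ≤ d) :
    ∃ P : Finset (Finset V),
      (∀ v : V, ∃! S, S ∈ P ∧ v ∈ S) ∧
      ∀ S ∈ P, 3 ≤ S.card ∧ S.card ≤ 2 * d + 1 ∧
        (G.induce (S : Set V)).Connected := by
  have hU : TreeSize.Cn G Finset.univ := by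
    intro a _ b _
    obtain ⟨p⟩ := hconn.preconnected a b
    induction p with
    | nil => exact .refl
    | cons h _ ih =>
      exact Relation.ReflTransGen.head ⟨h, Finset.mem_univ _, Finset.mem_univ _⟩
        (ih (Finset.mem_univ _) (Finset.mem_univ _))
  obtain ⟨P, hP, hP'⟩ := TreeSize.exists_partition G d hdeg _ Finset.univ rfl h3 hU
  refine ⟨P, fun v => hP v (Finset.mem_univ v), fun S hS => ?_⟩
  obtain ⟨_, h1, h2, h4⟩ := hP' S hS
  exact ⟨h1, h2, h4.induce (Finset.card_pos.1 (by omega))⟩
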